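/- arXiv:2210.02722 — 2 statements merged into one kernel-verified Lean document; each statement's English description precedes it below -/
import Mathlib

section
/- For every positive integer n: (1) if n is a perfect square, then ι(n) = 1; (2) if n is not a perfect square but every prime p with p ≡ 3 (mod 4) divides n to an even power, then ι(n) = 2; (3) if n = 4^r·(8t + 7) for some r, t ∈ ℕ, then ι(n) = 4; (4) in all remaining cases, ι(n) = 3. -/
/-- `iota n` is the least `s ≥ 1` such that `n` is a sum of `s` squares of positive integers. -/
noncomputable def iota (n : ℕ) : ℕ :=
  sInf {s : ℕ | ∃ c : Fin s → ℕ, (∀ i, 0 < c i) ∧ ∑ i, (c i) ^ 2 = n}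

/-- A binary positive definite integral form of determinant one is a sum of two squares of
integral linear forms. -/
theorem binary_unimodular_eq_gram (N : ℕ) : ∀ a h c : ℤ, (a + c).toNat ≤ N → 0 < a →
    a * c - h ^ 2 = 1 →
    ∃ p q r s : ℤ, a = p ^ 2 + r ^ 2 ∧ h = p * q + r * s ∧ c = q ^ 2 + s ^ 2 := by
  induction N with
  | zero =>
    intro a h c hN ha hd
    have hc : 0 < c := by
      by_contra! hc
      nlinarith [sq_nonneg h, mul_nonneg ha.le (neg_nonneg.mpr hc)]
    omega
  | succ N ih =>
    intro a h c hN ha hd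
    have hc : 0 < c := by
      by_contra! hc
      nlinarith [sq_nonneg h, mul_nonneg ha.le (neg_nonneg.mpr hc)]
    by_cases h1 : a < 2 * h
    · obtain ⟨p, q, r, s, e1, e2, e3⟩ := ih a (h - a) (c - 2 * h + a) (by omega) ha (by linarith)
      exact ⟨p, q + p, r, s + r, e1, by linarith, by linarith⟩
    by_cases h2 : a < -(2 * h)
    · obtain ⟨p, q, r, s, e1, e2, e3⟩ := ih a (h + a) (c + 2 * h + a) (by omega) ha (by linarith)
      exact ⟨p, q - p, r, s - r, e1, by linarith, by linarith⟩
    by_cases h3 : c < 2 * h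
    · have hd' : (a - 2 * h + c) * c - (h - c) ^ 2 = 1 := by linarith
      obtain ⟨p, q, r, s, e1, e2, e3⟩ := ih (a - 2 * h + c) (h - c) c (by omega)
        (by by_contra! h0; nlinarith [sq_nonneg (h - c)]) hd'
      exact ⟨p + q, q, r + s, s, by linarith, by linarith, e3⟩
    by_cases h4 : c < -(2 * h)
    · have hd' : (a + 2 * h + c) * c - (h + c) ^ 2 = 1 := by linarith
      obtain ⟨p, q, r, s, e1, e2, e3⟩ := ih (a + 2 * h + c) (h + c) c (by omega)
        (by by_contra! h0; nlinarith [sq_nonneg (h + c)]) hd'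
      exact ⟨p - q, q, r - s, s, by linarith, by linarith, e3⟩
    push Not at h1 h2 h3 h4
    have hle : 4 * h ^ 2 ≤ a * c := by
      rcases le_total 0 h with h0 | h0 <;> nlinarith
    have hh : h = 0 := by
      have : h ^ 2 < 1 := by linarith
      exact pow_eq_zero_iff two_ne_zero |>.mp (by nlinarith [sq_nonneg h])
    subst hh
    have hac : a * c = 1 := by linarith
    have ha1 : a = 1 := by nlinarith
    have hc1 : c = 1 := by nlinarith
    exact ⟨1, 0, 0, 1, by simp [ha1], by simp, by simp [hc1]⟩

/-- The ternary form with diagonal `a, b, c` and off-diagonal entries `d, e, f` is the Gram form of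
three integral vectors. -/
def IsGram (a b c d e f : ℤ) : Prop :=
  ∃ p₁ p₂ p₃ q₁ q₂ q₃ r₁ r₂ r₃ : ℤ,
    a = p₁ ^ 2 + p₂ ^ 2 + p₃ ^ 2 ∧ b = q₁ ^ 2 + q₂ ^ 2 + q₃ ^ 2 ∧ c = r₁ ^ 2 + r₂ ^ 2 + r₃ ^ 2 ∧
    d = q₁ * r₁ + q₂ * r₂ + q₃ * r₃ ∧ e = p₁ * r₁ + p₂ * r₂ + p₃ * r₃ ∧
    f = p₁ * q₁ + p₂ * q₂ + p₃ * q₃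

namespace IsGram

variable {a b c d e f : ℤ}

theorem swap_left (h : IsGram b a c e d f) : IsGram a b c d e f := by
  obtain ⟨p₁, p₂, p₃, q₁, q₂, q₃, r₁, r₂, r₃, h1, h2, h3, h4, h5, h6⟩ := h
  exact ⟨q₁, q₂, q₃, p₁, p₂, p₃, r₁, r₂, r₃, h2, h1, h3, h5, h4, by rw [h6]; ring⟩

theorem swap_right (h : IsGram a c b d f e) : IsGram a b c d e f := by
  obtain ⟨p₁, p₂, p₃, q₁, q₂, q₃, r₁, r₂, r₃, h1, h2, h3, h4, h5, h6⟩ := h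
  exact ⟨p₁, p₂, p₃, r₁, r₂, r₃, q₁, q₂, q₃, h1, h3, h2, by rw [h4]; ring, h6, h5⟩

theorem shear_left (k : ℤ)
    (h : IsGram a (b + 2 * k * f + k ^ 2 * a) c (d + k * e) e (f + k * a)) :
    IsGram a b c d e f := by
  obtain ⟨p₁, p₂, p₃, q₁, q₂, q₃, r₁, r₂, r₃, h1, h2, h3, h4, h5, h6⟩ := h
  refine ⟨p₁, p₂, p₃, q₁ - k * p₁, q₂ - k * p₂, q₃ - k * p₃, r₁, r₂, r₃, h1, ?_, h3, ?_, h5, ?_⟩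
  · linear_combination h2 - 2 * k * h6 + k ^ 2 * h1
  · linear_combination h4 - k * h5
  · linear_combination h6 - k * h1

theorem shear_right (k : ℤ)
    (h : IsGram a b (c + 2 * k * d + k ^ 2 * b) (d + k * b) (e + k * f) f) :
    IsGram a b c d e f := by
  obtain ⟨p₁, p₂, p₃, q₁, q₂, q₃, r₁, r₂, r₃, h1, h2, h3, h4, h5, h6⟩ := h
  refine ⟨p₁, p₂, p₃, q₁, q₂, q₃, r₁ - k * q₁, r₂ - k * q₂, r₃ - k * q₃, h1, h2, ?_, ?_, ?_, h6⟩
  · linear_combination h3 - 2 * k * h4 + k ^ 2 * h2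
  · linear_combination h4 - k * h2
  · linear_combination h5 - k * h6

end IsGram

theorem Int.exists_two_mul_abs_add_mul_le (h : ℤ) {m : ℤ} (hm : 0 < m) :
    ∃ k : ℤ, 2 * |h + k * m| ≤ m := by
  have h1 := Int.emod_add_mul_ediv h m
  have h2 := Int.emod_nonneg h hm.ne'
  have h3 := Int.emod_lt_of_pos h hm
  by_cases h4 : 2 * (h % m) ≤ m
  · refine ⟨-(h / m), ?_⟩
    rw [show h + -(h / m) * m = h % m by linarith, abs_of_nonneg h2]
    exact h4
  · refine ⟨-(h / m) - 1, ?_⟩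
    rw [show h + (-(h / m) - 1) * m = h % m - m by linarith, abs_of_neg (by linarith)]
    linarith

/-- A ternary positive definite integral form of determinant one is a sum of three squares of
integral linear forms. -/
theorem ternary_unimodular_isGram (N : ℕ) : ∀ (M : ℕ) (a b c d e f : ℤ), a.toNat ≤ N →
    (a * b - f ^ 2).toNat ≤ M → 0 < a → 0 < a * b - f ^ 2 →
    a * b * c + 2 * d * e * f - a * d ^ 2 - b * e ^ 2 - c * f ^ 2 = 1 → IsGram a b c d e f := by
  induction N with
  | zero => intros; omega
  | succ N ihN =>
    intro M
    induction M with
    | zero => intros; omega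
    | succ M ihM =>
      intro a b c d e f haN hAM ha hA hdet
      rcases eq_or_ne a 1 with rfl | ha1
      · obtain ⟨p, q, r, s, e1, e2, e3⟩ := binary_unimodular_eq_gram _ (1 * b - f ^ 2) (d - e * f)
          (c - e ^ 2) le_rfl hA (by linarith)
        exact ⟨1, 0, 0, f, p, r, e, q, s, by ring, by linarith, by linarith, by linarith,
          by ring, by ring⟩
      have ha2 : 2 ≤ a := by omega
      obtain ⟨k, hk⟩ := Int.exists_two_mul_abs_add_mul_le (a * d - e * f) hA
      refine IsGram.shear_right k ?_
      have hk' : 2 * |a * (d + k * b) - (e + k * f) * f| ≤ a * b - f ^ 2 := by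
        rwa [show a * (d + k * b) - (e + k * f) * f = a * d - e * f + k * (a * b - f ^ 2) by ring]
      have hdet' : a * b * (c + 2 * k * d + k ^ 2 * b) + 2 * (d + k * b) * (e + k * f) * f
          - a * (d + k * b) ^ 2 - b * (e + k * f) ^ 2 - (c + 2 * k * d + k ^ 2 * b) * f ^ 2 = 1 := by
        linarith
      generalize c + 2 * k * d + k ^ 2 * b = c at *
      generalize d + k * b = d at *
      generalize e + k * f = e at *
      clear hdet hk k
      have hbin : (a * b - f ^ 2) * (a * c - e ^ 2) - (a * d - e * f) ^ 2 = a := by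
        linear_combination a * hdet'
      have hC : 0 < a * c - e ^ 2 := by
        by_contra! h
        nlinarith [sq_nonneg (a * d - e * f)]
      by_cases hCA : a * c - e ^ 2 < a * b - f ^ 2
      · exact (ihM a c b d f e haN (by omega) ha hC (by linarith)).swap_right
      obtain ⟨k, hk⟩ := Int.exists_two_mul_abs_add_mul_le f ha
      refine IsGram.shear_left k ?_
      have hH : 4 * (a * d - e * f) ^ 2 ≤ (a * b - f ^ 2) ^ 2 := by
        have := abs_nonneg (a * d - e * f)
        rw [← sq_abs (a * d - e * f)]
        nlinarith
      have hA' : a * (b + 2 * k * f + k ^ 2 * a) - (f + k * a) ^ 2 = a * b - f ^ 2 := by ring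
      have hf : 4 * (f + k * a) ^ 2 ≤ a ^ 2 := by
        have := abs_nonneg (f + k * a)
        rw [← sq_abs (f + k * a)]
        nlinarith
      have hA3 : 3 * (a * b - f ^ 2) ^ 2 ≤ 4 * a := by
        push Not at hCA
        nlinarith
      have hb : b + 2 * k * f + k ^ 2 * a < a := by
        by_contra! h
        have h1 : 3 * a ^ 2 ≤ 4 * (a * b - f ^ 2) := by nlinarith
        have h2 : 6 * a ≤ 4 * (a * b - f ^ 2) := by nlinarith
        nlinarith
      have hb0 : 0 < b + 2 * k * f + k ^ 2 * a := by
        by_contra! h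
        nlinarith [sq_nonneg (f + k * a)]
      exact (ihN _ _ a c e (d + k * e) (f + k * a) (by omega) le_rfl hb0 (by linarith)
        (by linarith)).swap_left

/-- If `-b` is a square modulo `b * n - 1`, then `n` is a sum of three squares. -/
theorem exists_sum_three_sq_of_dvd {n b x : ℤ} (hb : 0 < b) (hbn : 0 < b * n - 1)
    (hx : b * n - 1 ∣ x ^ 2 + b) : ∃ u v w : ℤ, n = u ^ 2 + v ^ 2 + w ^ 2 := by
  obtain ⟨a, ha⟩ := hx
  have ha0 : 0 < a := by
    by_contra! h
    nlinarith [sq_nonneg x]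
  obtain ⟨-, -, -, -, -, -, u, v, w, -, -, h, -⟩ :=
    ternary_unimodular_isGram _ _ a (b * n - 1) n 0 1 x le_rfl le_rfl ha0 (by linarith)
      (by linear_combination (-n) * ha)
  exact ⟨u, v, w, h⟩

theorem jacobiSym_neg_eq_of_mod_four {p b : ℕ} (hb : Odd b)
    (h : p % 4 = 1 ∨ p % 4 = 3 ∧ b % 4 = 3) : jacobiSym (-b) p = jacobiSym p b := by
  have hp : Odd p := by rw [Nat.odd_iff]; omega
  rw [← neg_one_mul, jacobiSym.mul_left, jacobiSym.at_neg_one hp]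
  rcases h with h | ⟨h, h'⟩
  · rw [ZMod.χ₄_nat_one_mod_four h, one_mul, jacobiSym.quadratic_reciprocity_one_mod_four' hb h]
  · rw [ZMod.χ₄_nat_three_mod_four h, jacobiSym.quadratic_reciprocity_three_mod_four h' h]
    ring

theorem exists_dvd_sq_add_of_jacobiSym_eq_one {p b : ℕ} (hp : p.Prime)
    (h : jacobiSym (-b) p = 1) : ∃ x : ℤ, (p : ℤ) ∣ x ^ 2 + b := by
  have : Fact p.Prime := ⟨hp⟩
  obtain ⟨y, hy⟩ := ZMod.isSquare_of_jacobiSym_eq_one h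
  refine ⟨y.val, ?_⟩
  rw [← ZMod.intCast_zmod_eq_zero_iff_dvd]
  push_cast at hy ⊢
  rw [ZMod.natCast_zmod_val, sq, ← hy]
  ring

theorem exists_prime_eq_four_mul_add {n m : ℕ} (hn : 0 < n) (h : (4 * n).Coprime m) :
    ∃ p v : ℕ, p.Prime ∧ p = 4 * n * v + m := by
  obtain ⟨p, hpm, hp, hmod⟩ := Nat.forall_exists_prime_gt_and_modEq m (by omega) h.symm
  obtain ⟨v, hv⟩ := (Nat.modEq_iff_dvd' hpm.le).mp hmod.symm
  exact ⟨p, v, hp, by omega⟩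

theorem exists_sum_three_sq_of_mod_four_eq_two {n : ℕ} (hn : n % 4 = 2) :
    ∃ u v w : ℤ, (n : ℤ) = u ^ 2 + v ^ 2 + w ^ 2 := by
  have hcop : (4 * n).Coprime (n - 1) := by
    refine Nat.Coprime.mul_left ?_ ?_
    · exact Nat.Coprime.pow_left 2
        (Nat.coprime_two_left.mpr (Nat.odd_iff.mpr (by omega)))
    · rw [← Nat.isCoprime_iff_coprime]
      exact ⟨1, -1, by push_cast [show 1 ≤ n by omega]; ring⟩
  obtain ⟨p, v, hp, hpv⟩ := exists_prime_eq_four_mul_add (by omega) hcop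
  have hpb : ((4 * v + 1 : ℕ) : ℤ) * n - 1 = p := by
    rw [hpv]; push_cast [show 1 ≤ n by omega]; ring
  have hp4 : p % 4 = 1 := by rw [hpv, mul_assoc]; omega
  have hb : Odd (4 * v + 1) := Nat.odd_iff.mpr (by omega)
  have hJ : jacobiSym (-(4 * v + 1 : ℕ)) p = 1 := by
    rw [jacobiSym_neg_eq_of_mod_four hb (Or.inl hp4), ← hpb,
      jacobiSym.mod_left' (a₂ := -1) (by rw [sub_eq_add_neg]; exact Int.mul_add_emod_self_left _ _ _),
      jacobiSym.at_neg_one hb, ZMod.χ₄_nat_one_mod_four (by omega)]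
  obtain ⟨x, hx⟩ := exists_dvd_sq_add_of_jacobiSym_eq_one hp hJ
  exact exists_sum_three_sq_of_dvd (by positivity) (hpb ▸ mod_cast hp.pos) (hpb ▸ hx)

theorem exists_sum_three_sq_of_odd {n c m : ℕ} (hm : c * n = 2 * m + 1) (hmodd : m % 2 = 1)
    (hc : c = 1 ∧ m % 4 = 1 ∨ c = 3) : ∃ u v w : ℤ, (n : ℤ) = u ^ 2 + v ^ 2 + w ^ 2 := by
  have hn : 0 < n := by
    rcases Nat.eq_zero_or_pos n with rfl | h
    · omega
    · exact h
  have hcop : (4 * n).Coprime m := by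
    refine Nat.Coprime.mul_left ?_ ?_
    · exact Nat.Coprime.pow_left 2 (Nat.coprime_two_left.mpr (Nat.odd_iff.mpr hmodd))
    · rw [← Nat.isCoprime_iff_coprime]
      exact ⟨c, -2, by zify at hm; linarith⟩
  obtain ⟨p, v, hp, hpv⟩ := exists_prime_eq_four_mul_add hn hcop
  have hpb : ((8 * v + c : ℕ) : ℤ) * n - 1 = 2 * p := by
    zify at hm
    rw [hpv]; push_cast; linarith
  have hb : Odd (8 * v + c) := Nat.odd_iff.mpr (by omega)
  have hp4 : p % 4 = 1 ∨ p % 4 = 3 ∧ (8 * v + c) % 4 = 3 := by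
    rw [hpv, mul_assoc]; omega
  have h2 : jacobiSym (-2) (8 * v + c) = 1 := by
    rw [jacobiSym.at_neg_two hb, ZMod.χ₈'_nat_eq_if_mod_eight]
    rw [if_neg (by omega), if_pos (by omega)]
  have hJ : jacobiSym (-(8 * v + c : ℕ)) p = 1 := by
    rw [jacobiSym_neg_eq_of_mod_four hb hp4, ← one_mul (jacobiSym _ _), ← h2,
      ← jacobiSym.mul_left, show (-2 * p : ℤ) = 1 + (8 * v + c : ℕ) * (-n) by linarith,
      jacobiSym.mod_left' (a₂ := 1) (Int.add_mul_emod_self_left _ _ _), jacobiSym.one_left, h2]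
  obtain ⟨x, hx⟩ := exists_dvd_sq_add_of_jacobiSym_eq_one hp hJ
  have hp2 : IsCoprime (2 : ℤ) p := by
    have : (2 : ℕ).Coprime p := Nat.coprime_two_left.mpr (Nat.odd_iff.mpr (by omega))
    exact_mod_cast Nat.isCoprime_iff_coprime.mpr this
  have hp0 : 0 < (p : ℤ) := mod_cast hp.pos
  have hbZ : ((8 * v + c : ℕ) : ℤ) % 2 = 1 := by omega
  obtain ⟨y, hy, hy2⟩ : ∃ y : ℤ, (p : ℤ) ∣ y ^ 2 + (8 * v + c : ℕ) ∧ y % 2 = 1 := by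
    rcases Int.emod_two_eq_zero_or_one x with h | h
    · refine ⟨x + p, ?_, by omega⟩
      obtain ⟨k, hk⟩ := hx
      exact ⟨k + 2 * x + p, by linear_combination hk⟩
    · exact ⟨x, hx, h⟩
  have hdvd : (2 : ℤ) ∣ y ^ 2 + (8 * v + c : ℕ) := by
    rw [← even_iff_two_dvd]
    exact ((Int.odd_iff.mpr hy2).pow).add_odd (Int.odd_iff.mpr hbZ)
  exact exists_sum_three_sq_of_dvd (Int.natCast_pos.mpr hb.pos)
    (by rw [hpb]; positivity) (by rw [hpb]; exact hp2.mul_dvd hdvd hy)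

/-- **Legendre's three-square theorem**, existence part. -/
theorem Nat.exists_sum_three_sq (n : ℕ) (h : ¬ ∃ r t : ℕ, n = 4 ^ r * (8 * t + 7)) :
    ∃ x y z : ℕ, n = x ^ 2 + y ^ 2 + z ^ 2 := by
  induction n using Nat.strong_induction_on with
  | _ n ih =>
  rcases Nat.eq_zero_or_pos n with rfl | hn
  · exact ⟨0, 0, 0, rfl⟩
  by_cases h4 : n % 4 = 0
  · obtain ⟨k, rfl⟩ := Nat.dvd_of_mod_eq_zero h4
    obtain ⟨x, y, z, hk⟩ := ih k (by omega)
      (fun ⟨r, t, hrt⟩ => h ⟨r + 1, t, by rw [hrt]; ring⟩)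
    exact ⟨2 * x, 2 * y, 2 * z, by rw [hk]; ring⟩
  have h7 : n % 8 ≠ 7 := fun h7 => h ⟨0, n / 8, by omega⟩
  suffices ∃ u v w : ℤ, (n : ℤ) = u ^ 2 + v ^ 2 + w ^ 2 by
    obtain ⟨u, v, w, huvw⟩ := this
    exact ⟨u.natAbs, v.natAbs, w.natAbs, by zify; simpa using huvw⟩
  by_cases h2 : n % 4 = 2
  · exact exists_sum_three_sq_of_mod_four_eq_two h2
  by_cases h3 : n % 8 = 3
  · exact exists_sum_three_sq_of_odd (c := 1) (m := n / 2) (by omega) (by omega) (by omega)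
  · exact exists_sum_three_sq_of_odd (c := 3) (m := 3 * n / 2) (by omega) (by omega) (by omega)

/-- **Legendre's three-square theorem**, obstruction part. -/
theorem Nat.four_pow_mul_ne_sum_three_sq (r t x y z : ℕ) :
    4 ^ r * (8 * t + 7) ≠ x ^ 2 + y ^ 2 + z ^ 2 := by
  induction r generalizing x y z with
  | zero =>
    intro h
    have h8 : (x ^ 2 + y ^ 2 + z ^ 2) % 8 = 7 := by omega
    have sq_mod (a : ℕ) : a ^ 2 % 8 = 0 ∨ a ^ 2 % 8 = 1 ∨ a ^ 2 % 8 = 4 := by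
      have : a % 8 < 8 := Nat.mod_lt _ (by norm_num)
      rw [Nat.pow_mod]
      interval_cases a % 8 <;> simp
    have := sq_mod x
    have := sq_mod y
    have := sq_mod z
    omega
  | succ r ih =>
    intro h
    have h4 : (x ^ 2 + y ^ 2 + z ^ 2) % 4 = 0 := by
      rw [← h, pow_succ', mul_assoc, Nat.mul_mod_right]
    have sq_mod (a : ℕ) : a % 2 = 0 ∧ a ^ 2 % 4 = 0 ∨ a ^ 2 % 4 = 1 := by
      have : a % 4 < 4 := Nat.mod_lt _ (by norm_num)
      rw [Nat.pow_mod, ← Nat.mod_mod_of_dvd a (show 2 ∣ 4 by norm_num)]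
      interval_cases a % 4 <;> simp
    have hx := sq_mod x
    have hy := sq_mod y
    have hz := sq_mod z
    obtain ⟨x, rfl⟩ : 2 ∣ x := by omega
    obtain ⟨y, rfl⟩ : 2 ∣ y := by omega
    obtain ⟨z, rfl⟩ : 2 ∣ z := by omega
    exact ih x y z (by rw [pow_succ] at h; linarith)

theorem Nat.exists_eq_sq_add_sq_iff_even_factorization {n : ℕ} :
    (∃ x y : ℕ, n = x ^ 2 + y ^ 2) ↔
      ∀ p : ℕ, p.Prime → p % 4 = 3 → Even (n.factorization p) := by
  rw [Nat.eq_sq_add_sq_iff]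
  refine ⟨fun h p hp hp3 => ?_, fun h q hq hq3 => ?_⟩
  · by_cases hmem : p ∈ n.primeFactors
    · rw [Nat.factorization_def n hp]
      exact h p hmem hp3
    · rw [← Nat.support_factorization, Finsupp.notMem_support_iff] at hmem
      simp [hmem]
  · have hp := Nat.prime_of_mem_primeFactors hq
    rw [← Nat.factorization_def n hp]
    exact h q hp hq3

/-- `n` is a sum of `s` squares of positive integers. -/
def IsSumPosSq (n s : ℕ) : Prop :=
  ∃ c : Fin s → ℕ, (∀ i, 0 < c i) ∧ ∑ i, (c i) ^ 2 = n

theorem iota_eq_of_isSumPosSq {n s : ℕ} (h : IsSumPosSq n s) (hlt : ∀ k < s, ¬ IsSumPosSq n k) :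
    iota n = s := by
  refine le_antisymm (Nat.sInf_le h) ?_
  by_contra! hs
  exact hlt _ hs (Nat.sInf_mem (s := {s | IsSumPosSq n s}) ⟨s, h⟩)

theorem not_isSumPosSq_zero {n : ℕ} (hn : 0 < n) : ¬ IsSumPosSq n 0 := by
  rintro ⟨c, -, h⟩
  simp at h
  omega

theorem IsSumPosSq.exists_one {n : ℕ} (h : IsSumPosSq n 1) : ∃ m : ℕ, n = m ^ 2 := by
  obtain ⟨c, -, h⟩ := h
  exact ⟨c 0, by simpa using h.symm⟩

theorem IsSumPosSq.exists_two {n : ℕ} (h : IsSumPosSq n 2) : ∃ x y : ℕ, n = x ^ 2 + y ^ 2 := by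
  obtain ⟨c, -, h⟩ := h
  exact ⟨c 0, c 1, by simpa [Fin.sum_univ_succ] using h.symm⟩

theorem IsSumPosSq.exists_three {n : ℕ} (h : IsSumPosSq n 3) :
    ∃ x y z : ℕ, n = x ^ 2 + y ^ 2 + z ^ 2 := by
  obtain ⟨c, -, h⟩ := h
  exact ⟨c 0, c 1, c 2, by simpa [Fin.sum_univ_succ, add_assoc] using h.symm⟩

theorem isSumPosSq_sq {m : ℕ} (hm : 0 < m) : IsSumPosSq (m ^ 2) 1 :=
  ⟨![m], by simpa using hm, by simp⟩

theorem IsSumPosSq.add_sq {n s m : ℕ} (h : IsSumPosSq n s) (hm : 0 < m) :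
    IsSumPosSq (n + m ^ 2) (s + 1) := by
  obtain ⟨c, hc, rfl⟩ := h
  exact ⟨Fin.snoc c m, Fin.lastCases (by simpa using hm) (by simpa using hc),
    by simp [Fin.sum_univ_castSucc]⟩

theorem isSumPosSq_two_of_not_sq {n x y : ℕ} (hsq : ¬ ∃ m : ℕ, n = m ^ 2)
    (h : n = x ^ 2 + y ^ 2) : IsSumPosSq n 2 := by
  have hx : 0 < x := Nat.pos_of_ne_zero fun hx => hsq ⟨y, by simp [h, hx]⟩
  have hy : 0 < y := Nat.pos_of_ne_zero fun hy => hsq ⟨x, by simp [h, hy]⟩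
  exact h ▸ (isSumPosSq_sq hx).add_sq hy

theorem isSumPosSq_three_of_not_sum_two_sq {n x y z : ℕ}
    (h2 : ¬ ∃ x y : ℕ, n = x ^ 2 + y ^ 2) (h : n = x ^ 2 + y ^ 2 + z ^ 2) : IsSumPosSq n 3 := by
  have hx : 0 < x := Nat.pos_of_ne_zero fun hx => h2 ⟨y, z, by simp [h, hx]⟩
  have hy : 0 < y := Nat.pos_of_ne_zero fun hy => h2 ⟨x, z, by simp [h, hy]⟩
  have hz : 0 < z := Nat.pos_of_ne_zero fun hz => h2 ⟨x, y, by simp [h, hz]⟩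
  exact h ▸ ((isSumPosSq_sq hx).add_sq hy).add_sq hz

theorem isSumPosSq_four_of_not_sum_three_sq {n : ℕ}
    (h3 : ¬ ∃ x y z : ℕ, n = x ^ 2 + y ^ 2 + z ^ 2) : IsSumPosSq n 4 := by
  obtain ⟨a, b, c, d, h⟩ := Nat.sum_four_squares n
  have ha : 0 < a := Nat.pos_of_ne_zero fun ha => h3 ⟨b, c, d, by simp [← h, ha]⟩
  have hb : 0 < b := Nat.pos_of_ne_zero fun hb => h3 ⟨a, c, d, by simp [← h, hb]⟩
  have hc : 0 < c := Nat.pos_of_ne_zero fun hc => h3 ⟨a, b, d, by simp [← h, hc]⟩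
  have hd : 0 < d := Nat.pos_of_ne_zero fun hd => h3 ⟨a, b, c, by simp [← h, hd]⟩
  exact h ▸ (((isSumPosSq_sq ha).add_sq hb).add_sq hc).add_sq hd

theorem stmt2 (n : ℕ) (hn : 0 < n) :
    ((∃ m : ℕ, n = m ^ 2) → iota n = 1) ∧
    ((¬ ∃ m : ℕ, n = m ^ 2) ∧
        (∀ p : ℕ, p.Prime → p % 4 = 3 → Even (n.factorization p)) → iota n = 2) ∧
    ((∃ r t : ℕ, n = 4 ^ r * (8 * t + 7)) → iota n = 4) ∧
    ((¬ ∃ m : ℕ, n = m ^ 2) ∧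
        (¬ ∀ p : ℕ, p.Prime → p % 4 = 3 → Even (n.factorization p)) ∧
        (¬ ∃ r t : ℕ, n = 4 ^ r * (8 * t + 7)) → iota n = 3) := by
  simp only [← Nat.exists_eq_sq_add_sq_iff_even_factorization]
  have h0 := not_isSumPosSq_zero hn
  refine ⟨?_, ?_, ?_, ?_⟩
  · rintro ⟨m, rfl⟩
    refine iota_eq_of_isSumPosSq (isSumPosSq_sq (Nat.pos_of_ne_zero ?_)) ?_
    · rintro rfl
      simp at hn
    · intro k hk
      interval_cases k
      exact h0
  · rintro ⟨h1, x, y, h⟩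
    refine iota_eq_of_isSumPosSq (isSumPosSq_two_of_not_sq h1 h) fun k hk => ?_
    interval_cases k
    · exact h0
    · exact fun hk => h1 hk.exists_one
  · rintro ⟨r, t, h⟩
    have h3 : ¬ ∃ x y z : ℕ, n = x ^ 2 + y ^ 2 + z ^ 2 := fun ⟨x, y, z, hxyz⟩ =>
      Nat.four_pow_mul_ne_sum_three_sq r t x y z (h ▸ hxyz)
    refine iota_eq_of_isSumPosSq (isSumPosSq_four_of_not_sum_three_sq h3) fun k hk hs => ?_
    interval_cases k
    · exact h0 hs
    · obtain ⟨x, hx⟩ := hs.exists_one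
      exact h3 ⟨x, 0, 0, by simpa using hx⟩
    · obtain ⟨x, y, hxy⟩ := hs.exists_two
      exact h3 ⟨x, y, 0, by simpa using hxy⟩
    · exact h3 hs.exists_three
  · rintro ⟨h1, h2, h7⟩
    obtain ⟨x, y, z, h⟩ := Nat.exists_sum_three_sq n h7
    refine iota_eq_of_isSumPosSq (isSumPosSq_three_of_not_sum_two_sq h2 h) fun k hk => ?_
    interval_cases k
    · exact h0
    · exact fun hk => h1 hk.exists_one
    · exact fun hk => h2 hk.exists_two
end

section
/- For every positive integer k there exist functions t, r : {0, 1, …, k²−1} → ℕ, both weakly increasing in the index, with t(k²−1) − t(0) ≤ 1, such that for every integer a ≥ (⌈3k/2⌉ + 1)·k², writing j = a mod k², the Frobenius number of the set {a} ∪ {a + i² : 1 ≤ i ≤ k} equals t(j)·a + r(j) + (a + k²)·(⌊a/k²⌋ − ⌈3k/2⌉ − 1). -/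
/-- `SumSq k n s` says that `s` is a sum of `n` squares of natural numbers that are at most `k`. -/
def SumSq (k : ℕ) : ℕ → ℕ → Prop
  | 0, s => s = 0
  | n + 1, s => ∃ i ≤ k, ∃ s', SumSq k n s' ∧ s = s' + i ^ 2

namespace SumSq

variable {k n m s u : ℕ}

theorem cons (h : SumSq k n s) {i : ℕ} (hi : i ≤ k) : SumSq k (n + 1) (s + i ^ 2) :=
  ⟨i, hi, s, h, rfl⟩

theorem mono (h : SumSq k n s) (hnm : n ≤ m) : SumSq k m s := by
  induction hnm with
  | refl => exact h
  | step _ ih => simpa using ih.cons (Nat.zero_le k)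

theorem add (h : SumSq k n s) (h' : SumSq k m u) : SumSq k (n + m) (s + u) := by
  induction m generalizing u with
  | zero =>
    obtain rfl : u = 0 := h'
    exact h
  | succ m ih =>
    obtain ⟨i, hi, v, hv, rfl⟩ := h'
    simpa only [Nat.add_assoc] using (ih hv).cons hi

theorem le_mul (h : SumSq k n s) : s ≤ n * k ^ 2 := by
  induction n generalizing s with
  | zero =>
    obtain rfl : s = 0 := h
    simp
  | succ n ih =>
    obtain ⟨i, hi, v, hv, rfl⟩ := h
    have := ih hv
    have := Nat.pow_le_pow_left hi 2
    linarith

theorem mul_sq (k n : ℕ) : SumSq k n (n * k ^ 2) := by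
  induction n with
  | zero => exact Nat.zero_mul _
  | succ n ih => simpa [Nat.succ_mul] using ih.cons le_rfl

/-- In a sum of squares of numbers at most `k + 1`, either `k + 1` does not occur, or one
occurrence of it can be removed. -/
theorem of_succ {d : ℕ} (h : SumSq (d + 1) n s) :
    SumSq d n s ∨ ∃ n' s', n = n' + 1 ∧ s = s' + (d + 1) ^ 2 ∧ SumSq (d + 1) n' s' := by
  induction n generalizing s with
  | zero => exact Or.inl h
  | succ n ih =>
    obtain ⟨i, hi, v, hv, rfl⟩ := h
    rcases Nat.lt_or_ge d i with hdi | hdi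
    · obtain rfl : i = d + 1 := by omega
      exact Or.inr ⟨n, v, rfl, rfl, hv⟩
    · rcases ih hv with h | ⟨n', s', rfl, rfl, h⟩
      · exact Or.inl (h.cons hdi)
      · exact Or.inr ⟨n' + 1, s' + i ^ 2, rfl, by ring, h.cons hi⟩

theorem div_add_four (hk : 0 < k) (x : ℕ) : SumSq k (x / k ^ 2 + 4) x := by
  obtain ⟨a, b, c, d, h⟩ := Nat.sum_four_squares (x % k ^ 2)
  have hlt : x % k ^ 2 < k ^ 2 := Nat.mod_lt _ (by positivity)
  have root_le {y : ℕ} (hy : y ^ 2 < k ^ 2) : y ≤ k := (lt_of_pow_lt_pow_left₀ 2 hk.le hy).le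
  have h4 := ((((mul_sq k (x / k ^ 2)).cons (root_le (y := a) (by omega))).cons
    (root_le (y := b) (by omega))).cons (root_le (y := c) (by omega))).cons
    (root_le (y := d) (by omega))
  convert h4 using 1
  have := Nat.div_add_mod' x (k ^ 2)
  omega

theorem mem_closure_iff {a m : ℕ} :
    m ∈ AddSubmonoid.closure
        (({a} : Set ℕ) ∪ {n : ℕ | ∃ i : ℕ, 1 ≤ i ∧ i ≤ k ∧ n = a + i ^ 2}) ↔
      ∃ n s, SumSq k n s ∧ m = n * a + s := by
  constructor
  · intro h
    induction h using AddSubmonoid.closure_induction with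
    | mem x hx =>
      have h0 : SumSq k 0 0 := rfl
      rcases hx with rfl | ⟨i, -, hi, rfl⟩
      · exact ⟨1, 0, h0.mono zero_le_one, by simp⟩
      · exact ⟨1, i ^ 2, by simpa using h0.cons hi, by simp⟩
    | zero => exact ⟨0, 0, rfl, by simp⟩
    | add x y _ _ hx hy =>
      obtain ⟨n, s, h, rfl⟩ := hx
      obtain ⟨m, u, h', rfl⟩ := hy
      exact ⟨n + m, s + u, h.add h', by ring⟩
  · rintro ⟨n, s, h, rfl⟩
    induction n generalizing s with
    | zero =>
      obtain rfl : s = 0 := h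
      simp
    | succ n ih =>
      obtain ⟨i, hi, v, hv, rfl⟩ := h
      have hgen : a + i ^ 2 ∈ AddSubmonoid.closure
          (({a} : Set ℕ) ∪ {n : ℕ | ∃ i : ℕ, 1 ≤ i ∧ i ≤ k ∧ n = a + i ^ 2}) := by
        apply AddSubmonoid.subset_closure
        rcases Nat.eq_zero_or_pos i with rfl | hpos
        · left
          simp
        · exact Or.inr ⟨i, hpos, hi, rfl⟩
      have hsum := add_mem (ih v hv) hgen
      rwa [show (n + 1) * a + (v + i ^ 2) = n * a + v + (a + i ^ 2) by ring]

end SumSq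

/-- The least number of squares of numbers at most `k` that sum to `x`. -/
noncomputable def minSq (k x : ℕ) : ℕ := sInf {n | SumSq k n x}

section minSq

variable {k n x : ℕ}

theorem sumSq_minSq (hk : 0 < k) (x : ℕ) : SumSq k (minSq k x) x :=
  Nat.sInf_mem (Set.nonempty_of_mem (show x / k ^ 2 + 4 ∈ {n | SumSq k n x} from
    SumSq.div_add_four hk x))

theorem minSq_le (h : SumSq k n x) : minSq k x ≤ n := Nat.sInf_le h

theorem minSq_mul_le (hk : 0 < k) (x : ℕ) : minSq k x * k ^ 2 ≤ x + 4 * k ^ 2 := by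
  have h := Nat.mul_le_mul_right (k ^ 2) (minSq_le (SumSq.div_add_four hk x))
  have := Nat.div_mul_le_self x (k ^ 2)
  rw [Nat.add_mul] at h
  omega

theorem le_minSq_mul (hk : 0 < k) (x : ℕ) : x ≤ minSq k x * k ^ 2 := (sumSq_minSq hk x).le_mul

theorem minSq_add_sq_le (hk : 0 < k) (x : ℕ) : minSq k (x + k ^ 2) ≤ minSq k x + 1 :=
  minSq_le ((sumSq_minSq hk x).cons le_rfl)

end minSq

/-- `X` is the last point below `a` at which `minSq k` attains its maximum over `[0, a)`. -/
def IsLastMax (k a X : ℕ) : Prop :=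
  X < a ∧ ∀ x < a, minSq k x < minSq k X ∨ minSq k x = minSq k X ∧ x ≤ X

theorem exists_isLastMax (k : ℕ) {a : ℕ} (ha : 0 < a) : ∃ X, IsLastMax k a X := by
  induction a, ha using Nat.le_induction with
  | base => exact ⟨0, zero_lt_one, fun x hx => Or.inr (by simp [Nat.lt_one_iff.1 hx])⟩
  | succ a _ ih =>
    obtain ⟨X, hX, h⟩ := ih
    by_cases hlt : minSq k a < minSq k X
    · refine ⟨X, by omega, fun x hx => ?_⟩
      rcases Nat.lt_succ_iff_lt_or_eq.1 hx with hx | rfl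
      · exact h x hx
      · exact Or.inl hlt
    · refine ⟨a, by omega, fun x hx => ?_⟩
      rcases Nat.lt_succ_iff_lt_or_eq.1 hx with hx | rfl
      · have := h x hx
        omega
      · exact Or.inr ⟨rfl, le_rfl⟩

namespace IsLastMax

variable {k a b c X Y : ℕ}

theorem minSq_le (h : IsLastMax k a X) {x : ℕ} (hx : x < a) : minSq k x ≤ minSq k X := by
  have := h.2 x hx
  omega

theorem minSq_mono (h : IsLastMax k a X) (h' : IsLastMax k b Y) (hab : a ≤ b) :
    minSq k X ≤ minSq k Y :=
  h'.minSq_le (h.1.trans_le hab)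

theorem mono (h : IsLastMax k a X) (h' : IsLastMax k b Y) (hab : a ≤ b) : X ≤ Y := by
  have h1 := h'.2 X (h.1.trans_le hab)
  by_contra hYX
  have h2 := h.2 Y (by have := h.1; omega)
  omega

theorem minSq_pos (hk : 0 < k) (ha : 1 < a) (h : IsLastMax k a X) : 0 < minSq k X := by
  have h1 := h.minSq_le ha
  have h2 := le_minSq_mul hk 1
  rcases Nat.eq_zero_or_pos (minSq k 1) with h0 | h0
  · simp [h0] at h2
  · omega

theorem minSq_add_sq (hk : 0 < k) (hc : 3 * k + 2 ≤ 2 * c) (ha : c * k ^ 2 ≤ a)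
    (h : IsLastMax k a X) : minSq k (X + k ^ 2) = minSq k X + 1 := by
  refine le_antisymm (minSq_add_sq_le hk X) (Nat.succ_le_of_lt ?_)
  by_contra! hle
  have hup := minSq_mul_le hk X
  have hK : 0 < k ^ 2 := by positivity
  have hnear : a ≤ X + 4 * k ^ 2 := by
    by_contra! hfar
    have h1 := h.2 (X + 4 * k ^ 2) hfar
    have h2 := le_minSq_mul hk (X + 4 * k ^ 2)
    have h3 : minSq k (X + 4 * k ^ 2) + 1 ≤ minSq k X := by omega
    have := Nat.mul_le_mul_right (k ^ 2) h3
    linarith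
  obtain ⟨d, rfl⟩ : ∃ d, k = d + 1 := ⟨k - 1, by omega⟩
  set Z := X + (d + 1) ^ 2 with hZ
  rcases (sumSq_minSq hk Z).of_succ with hsmall | ⟨n, s, hn, hs, hrep⟩
  · have hbound := hsmall.le_mul
    rcases Nat.lt_or_ge Z a with hZa | hZa
    · have h1 := h.2 Z hZa
      have h3 : minSq (d + 1) Z + 1 ≤ minSq (d + 1) X := by omega
      have h4 := Nat.mul_le_mul_right ((d + 1) ^ 2) h3
      have h5 : minSq (d + 1) Z * (d + 1) ^ 2 ≤ Z + 2 * (d + 1) ^ 2 := by linarith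
      have h6 := Nat.mul_le_mul_right (d ^ 2) h5
      have h7 := Nat.mul_le_mul_right ((d + 1) ^ 2) hbound
      have h8 : Z * (2 * d + 1) ≤ 2 * d ^ 2 * (d + 1) ^ 2 := by nlinarith
      have h9 : c * (d + 1) ^ 2 ≤ Z + 3 * (d + 1) ^ 2 := by omega
      have h10 := Nat.mul_le_mul_right (2 * d + 1) h9
      have h11 : c * (2 * d + 1) ≤ 2 * d ^ 2 + 3 * (2 * d + 1) := by
        refine Nat.le_of_mul_le_mul_right ?_ hK
        linarith
      have hd : d = 0 := by nlinarith
      subst hd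
      simp at hbound
    · have h4 := Nat.mul_le_mul_right ((d + 1) ^ 2) hle
      have h5 : minSq (d + 1) Z * (d + 1) ^ 2 ≤ Z + 3 * (d + 1) ^ 2 := by linarith
      have h6 := Nat.mul_le_mul_right (d ^ 2) h5
      have h7 := Nat.mul_le_mul_right ((d + 1) ^ 2) hbound
      have h8 : Z * (2 * d + 1) ≤ 3 * d ^ 2 * (d + 1) ^ 2 := by nlinarith
      have h10 := Nat.mul_le_mul_right (2 * d + 1) (ha.trans hZa)
      have h11 : c * (2 * d + 1) ≤ 3 * d ^ 2 := by
        refine Nat.le_of_mul_le_mul_right ?_ hK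
        linarith
      nlinarith
  · obtain rfl : s = X := by omega
    have := _root_.minSq_le hrep
    omega

theorem add_sq (hk : 0 < k) (hc : 3 * k + 2 ≤ 2 * c) (ha : c * k ^ 2 ≤ a)
    (h : IsLastMax k a X) : IsLastMax k (a + k ^ 2) (X + k ^ 2) := by
  have heq := h.minSq_add_sq hk hc ha
  refine ⟨by have := h.1; omega, fun x hx => ?_⟩
  rcases Nat.lt_or_ge x (k ^ 2) with hxk | hxk
  · have h4 : minSq k x ≤ 4 := by
      simpa [Nat.div_eq_of_lt hxk] using _root_.minSq_le (SumSq.div_add_four hk x)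
    have h3 : 3 * k ^ 2 ≤ a := (Nat.mul_le_mul_right _ (by omega)).trans ha
    have h1 := h.minSq_le (x := x + 2 * k ^ 2) (by omega)
    have h2 := le_minSq_mul hk (x + 2 * k ^ 2)
    rcases Nat.eq_zero_or_pos x with rfl | hx0
    · have : minSq k 0 ≤ 0 := _root_.minSq_le (k := k) (n := 0) (x := 0) rfl
      omega
    · have : 2 < minSq k (x + 2 * k ^ 2) := lt_of_mul_lt_mul_right (by omega) (Nat.zero_le (k ^ 2))
      omega
  · obtain ⟨y, rfl⟩ := Nat.exists_eq_add_of_le' hxk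
    have h1 := h.2 y (by omega)
    have h2 := minSq_add_sq_le hk y
    omega

theorem add_mul_sq (hk : 0 < k) (hc : 3 * k + 2 ≤ 2 * c) (ha : c * k ^ 2 ≤ a)
    (h : IsLastMax k a X) (q : ℕ) :
    IsLastMax k (a + q * k ^ 2) (X + q * k ^ 2) ∧ minSq k (X + q * k ^ 2) = minSq k X + q := by
  induction q with
  | zero => simpa using h
  | succ q ih =>
    have hle : c * k ^ 2 ≤ a + q * k ^ 2 := by omega
    have h1 := ih.1.add_sq hk hc hle
    have h2 := ih.1.minSq_add_sq hk hc hle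
    rw [Nat.succ_mul, ← Nat.add_assoc, ← Nat.add_assoc]
    exact ⟨h1, by omega⟩

theorem isGreatest (hk : 0 < k) (ha1 : 1 < a) (ha : 3 * k ^ 2 ≤ a) (h : IsLastMax k a X) :
    IsGreatest
      {n : ℕ | n ∉ AddSubmonoid.closure
        (({a} : Set ℕ) ∪ {n : ℕ | ∃ i : ℕ, 1 ≤ i ∧ i ≤ k ∧ n = a + i ^ 2})}
      ((minSq k X - 1) * a + X) := by
  have hpos := h.minSq_pos hk ha1
  have hXa := h.1
  obtain ⟨p, hp⟩ : ∃ p, minSq k X = p + 1 := ⟨minSq k X - 1, by omega⟩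
  rw [hp, Nat.add_sub_cancel]
  constructor
  · intro hmem
    obtain ⟨n, s, hs, heq⟩ := SumSq.mem_closure_iff.1 hmem
    have hnp : n ≤ p := by
      by_contra! hlt
      have := Nat.mul_le_mul_right a (Nat.succ_le_of_lt hlt)
      rw [Nat.succ_mul] at this
      omega
    obtain ⟨l, rfl⟩ := Nat.exists_eq_add_of_le hnp
    obtain rfl : s = l * a + X := by linarith
    rcases Nat.eq_zero_or_pos l with rfl | hl
    · have := _root_.minSq_le hs
      simp at this
      omega
    · have h1 := hs.le_mul
      have h2 := minSq_mul_le hk X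
      rw [hp] at h2
      have h3 := Nat.mul_le_mul_left l ha
      have hK : 0 < k ^ 2 := by positivity
      nlinarith
  · intro m hm
    by_contra! hlt
    apply hm
    have hdm := Nat.div_add_mod' m a
    have hmod := Nat.mod_lt m (by omega : a > 0)
    refine SumSq.mem_closure_iff.2
      ⟨m / a, m % a, (sumSq_minSq hk _).mono ?_, hdm.symm⟩
    by_contra! hq
    have hmax := h.2 _ hmod
    rcases Nat.lt_or_ge (m / a) p with hqp | hqp
    · have := Nat.mul_le_mul_right a (Nat.succ_le_of_lt hqp)
      rw [Nat.succ_mul] at this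
      omega
    · have : m / a = p := by omega
      rw [this] at hdm
      omega

end IsLastMax

theorem stmt16 (k : ℕ) (hk : 0 < k) :
    ∃ t r : ℕ → ℕ,
      (∀ i j : ℕ, i ≤ j → j < k ^ 2 → t i ≤ t j) ∧
      (∀ i j : ℕ, i ≤ j → j < k ^ 2 → r i ≤ r j) ∧
      t (k ^ 2 - 1) - t 0 ≤ 1 ∧
      ∀ a : ℕ, ((3 * k + 1) / 2 + 1) * k ^ 2 ≤ a →
        IsGreatest
          {n : ℕ | n ∉ AddSubmonoid.closure
            (({a} : Set ℕ) ∪ {n : ℕ | ∃ i : ℕ, 1 ≤ i ∧ i ≤ k ∧ n = a + i ^ 2})}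
          (t (a % k ^ 2) * a + r (a % k ^ 2)
            + (a + k ^ 2) * (a / k ^ 2 - ((3 * k + 1) / 2 + 1))) := by
  obtain ⟨c, hcdef⟩ : ∃ c, c = (3 * k + 1) / 2 + 1 := ⟨_, rfl⟩
  rw [← hcdef]
  have hc : 3 * k + 2 ≤ 2 * c := by omega
  have hK : 0 < k ^ 2 := by positivity
  have h3 : 3 * k ^ 2 ≤ c * k ^ 2 := Nat.mul_le_mul_right _ (by omega)
  choose X hX using fun j : ℕ => exists_isLastMax k (a := c * k ^ 2 + j) (by omega)
  refine ⟨fun j => minSq k (X j) - 1, X, fun i j hij _ => ?_, fun i j hij _ => ?_, ?_,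
    fun a ha => ?_⟩
  · exact Nat.sub_le_sub_right ((hX i).minSq_mono (hX j) (by omega)) 1
  · exact (hX i).mono (hX j) (by omega)
  · have h1 := (hX 0).add_sq hk hc (by omega)
    have h2 := (hX 0).minSq_add_sq hk hc (by omega)
    have := (hX (k ^ 2 - 1)).minSq_mono h1 (by omega)
    dsimp only
    omega
  · obtain ⟨q, hq⟩ := Nat.exists_eq_add_of_le ((Nat.le_div_iff_mul_le hK).2 ha)
    have hdm := Nat.div_add_mod' a (k ^ 2)
    generalize a % k ^ 2 = j at hdm ⊢
    obtain ⟨h1, h2⟩ := (hX j).add_mul_sq hk hc (by omega) q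
    have hpos := (hX j).minSq_pos hk (by omega)
    obtain ⟨p, hp⟩ : ∃ p, minSq k (X j) = p + 1 := ⟨minSq k (X j) - 1, by omega⟩
    have hae : c * k ^ 2 + j + q * k ^ 2 = a := by
      rw [← hdm, hq]
      ring
    rw [hae] at h1
    have hmain := h1.isGreatest hk (by omega) (by omega)
    rw [h2, hp, show p + 1 + q - 1 = p + q by omega] at hmain
    dsimp only
    rw [hq, Nat.add_sub_cancel_left, hp, Nat.add_sub_cancel]
    convert hmain using 1
    ring
end
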